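/- For k ≥ 1 and ℓ ≥ 0, define the family of trees 𝒯_{k,ℓ} recursively: 𝒯_{1,ℓ} = {K_1}, and T ∈ 𝒯_{k,ℓ} if T is formed from the disjoint union of trees T_1, T_2, T_3 ∈ 𝒯_{k-1,ℓ}, by choosing vertices r_1 ∈ T_1, r_2 ∈ T_2, r_3 ∈ T_3 and joining each r_i by a path of length 2ℓ+2 to a common new vertex q. Then every T ∈ 𝒯_{k,ℓ} satisfies c_ℓ(T) = k. -/

import Mathlib

namespace CopsRobber

open Classical

noncomputable section

variable {V : Type*}

/-- Observation available to the cops: the robber's position is revealed iff some cop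
is within graph distance `ℓ` of the robber. -/
def obs (G : SimpleGraph V) (ℓ : ℕ∞) {k : ℕ} (p : Fin k → V) (r : V) : Option V :=
  if ∃ i, (G.dist (p i) r : ℕ∞) ≤ ℓ then some r else none

/-- A strategy for `k` cops on `G`: initial positions, and a move function depending on the
history of observations and the current cop positions.  Each cop moves along an edge or
passes. -/
structure CopStrategy (G : SimpleGraph V) (k : ℕ) where
  init : Fin k → V
  move : List (Option V) → (Fin k → V) → Fin k → V
  valid : ∀ h p i, move h p i = p i ∨ G.Adj (p i) (move h p i)

/-- A robber trajectory: in each round the robber moves along an edge or passes. -/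
def RobberWalk (G : SimpleGraph V) (R : ℕ → V) : Prop :=
  ∀ t, R (t + 1) = R t ∨ G.Adj (R t) (R (t + 1))

/-- The play of the game: cop positions and observation history at the end of each round.
In round `t+1` the cops move first (observing the robber at his position of round `t` if
within range), then the robber moves (and is observed at his new position if within range). -/
def play (G : SimpleGraph V) (ℓ : ℕ∞) {k : ℕ} (σ : CopStrategy G k) (R : ℕ → V) :
    ℕ → (Fin k → V) × List (Option V)
  | 0 => (σ.init, [obs G ℓ σ.init (R 0)])
  | t + 1 =>
    let s := play G ℓ σ R t
    let p := σ.move s.2 s.1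
    (p, (s.2 ++ [obs G ℓ p (R t)]) ++ [obs G ℓ p (R (t + 1))])

/-- Positions of the cops at the end of round `t`. -/
def copsAt (G : SimpleGraph V) (ℓ : ℕ∞) {k : ℕ} (σ : CopStrategy G k) (R : ℕ → V)
    (t : ℕ) : Fin k → V :=
  (play G ℓ σ R t).1

/-- The cops capture the robber: some cop occupies the robber's vertex, either
simultaneously or by moving onto it mid-round. -/
def Captures (G : SimpleGraph V) (ℓ : ℕ∞) {k : ℕ} (σ : CopStrategy G k) (R : ℕ → V) : Prop :=
  ∃ t i, copsAt G ℓ σ R t i = R t ∨ copsAt G ℓ σ R (t + 1) i = R t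

/-- The cops see the robber: some cop comes within distance `ℓ` of the robber. -/
def Sees (G : SimpleGraph V) (ℓ : ℕ∞) {k : ℕ} (σ : CopStrategy G k) (R : ℕ → V) : Prop :=
  ∃ t i, (G.dist (copsAt G ℓ σ R t i) (R t) : ℕ∞) ≤ ℓ ∨
    (G.dist (copsAt G ℓ σ R (t + 1) i) (R t) : ℕ∞) ≤ ℓ

/-- `c_ℓ(G)`: the minimum number of cops that guarantee capture of the robber in the
`ℓ`-visibility Cops and Robber game. -/
def visCopNumber (G : SimpleGraph V) (ℓ : ℕ∞) : ℕ :=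
  sInf {k | ∃ σ : CopStrategy G k, ∀ R, RobberWalk G R → Captures G ℓ σ R}

/-- `c'_ℓ(G)`: the minimum number of cops that guarantee seeing the robber in the
`ℓ`-visibility Cops and Robber game. -/
def visSeeNumber (G : SimpleGraph V) (ℓ : ℕ∞) : ℕ :=
  sInf {k | ∃ σ : CopStrategy G k, ∀ R, RobberWalk G R → Sees G ℓ σ R}

/-- The classical cop number: the game with full visibility. -/
def copNumber (G : SimpleGraph V) : ℕ := visCopNumber G ⊤

end
end CopsRobber


universe u

/-- `InFam ℓ k V G` says that the graph `G` belongs to the family `𝒯_{k,ℓ}`: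
`𝒯_{1,ℓ} = {K₁}`, and a member of `𝒯_{k+2?,ℓ}`(i.e. level `k+2`) is formed from three
disjoint members `T₁, T₂, T₃` of the previous level, joining a chosen vertex `r i = P i 0`
of each `T i` by a path `P i` of length `2ℓ+2` to a common new vertex `q`. -/
def InFam (ℓ : ℕ) : (k : ℕ) → (V : Type u) → SimpleGraph V → Prop
  | 0, _, _ => False
  | 1, V, _ => Nonempty V ∧ ∀ a b : V, a = b
  | k + 2, V, G =>
    ∃ (S : Fin 3 → Set V) (P : Fin 3 → ℕ → V) (q : V),
      (∀ i, P i 0 ∈ S i) ∧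
      (∀ i, P i (2 * ℓ + 2) = q) ∧
      (∀ i, InFam ℓ (k + 1) (S i) (G.induce (S i))) ∧
      Pairwise (Function.onFun Disjoint S) ∧
      (∀ i, ∀ j : ℕ, 1 ≤ j → j ≤ 2 * ℓ + 2 → ∀ i', P i j ∉ S i') ∧
      (Function.Injective fun p : Fin 3 × Fin (2 * ℓ + 2) => P p.1 (p.2 : ℕ)) ∧
      (∀ i, ∀ j : ℕ, j ≤ 2 * ℓ + 1 → P i j ≠ q) ∧
      (∀ v : V, (∃ i, v ∈ S i) ∨ ∃ i, ∃ j ≤ 2 * ℓ + 2, P i j = v) ∧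
      (∀ i, ∀ j : ℕ, j < 2 * ℓ + 2 → G.Adj (P i j) (P i (j + 1))) ∧
      (∀ a b : V, G.Adj a b →
        (∃ i, a ∈ S i ∧ b ∈ S i) ∨
        ∃ i, ∃ j < 2 * ℓ + 2,
          (a = P i j ∧ b = P i (j + 1)) ∨ (b = P i j ∧ a = P i (j + 1)))

namespace CopsRobber

variable {V : Type u} {W : Type u}

/-- Three sets `S i` joined by paths `P i` of length `L` to a common vertex `q`, described through
the height `h v` of a vertex along its path (`0` on the `S i`, `L` at `q`) and the branch `b v` it
belongs to. -/
structure IsTripod (G : SimpleGraph V) (L : ℕ) (S : Fin 3 → Set V) (P : Fin 3 → ℕ → V) (q : V)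
    (h : V → ℕ) (b : V → Fin 3) : Prop where
  mem_iff : ∀ i v, v ∈ S i ↔ h v = 0 ∧ b v = i
  le : ∀ v, h v ≤ L
  pos : 0 < L
  h_path : ∀ i j, j ≤ L → h (P i j) = j
  b_path : ∀ i j, j < L → b (P i j) = i
  eq_path : ∀ v, 0 < h v → v = P (b v) (h v)
  top : ∀ i, P i L = q
  adj_path : ∀ i j, j < L → G.Adj (P i j) (P i (j + 1))
  adj_cases : ∀ x y, G.Adj x y → (h x = 0 ∧ h y = 0 ∧ b x = b y) ∨
    ∃ i j, j < L ∧ ((x = P i j ∧ y = P i (j + 1)) ∨ (y = P i j ∧ x = P i (j + 1)))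

theorem exists_isTripod {ℓ k : ℕ} {G : SimpleGraph V} (hG : InFam ℓ (k + 2) V G) :
    ∃ S P q h b, IsTripod G (2 * ℓ + 2) S P q h b ∧
      ∀ i, InFam ℓ (k + 1) (S i) (G.induce (S i)) := by
  obtain ⟨S, P, q, h0, htop, hfam, hdisj, hnot, hinj, hne, hcov, hadj, hcase⟩ := hG
  have hinj' : ∀ i j i' j', j < 2 * ℓ + 2 → j' < 2 * ℓ + 2 → P i j = P i' j' → i = i' ∧ j = j' := by
    intro i j i' j' hj hj' he
    have := @hinj (i, ⟨j, hj⟩) (i', ⟨j', hj'⟩) he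
    simpa using this
  have hd : ∀ i i' v, v ∈ S i → v ∈ S i' → i = i' := by
    intro i i' v hv hv'
    by_contra hn
    exact Set.disjoint_left.1 (hdisj hn) hv hv'
  let lvl : Fin 3 → ℕ → V → Prop := fun i j v =>
    j ≤ 2 * ℓ + 2 ∧ ((j = 0 ∧ v ∈ S i) ∨ (0 < j ∧ v = P i j))
  have hex : ∀ v, ∃ x : Fin 3 × ℕ, lvl x.1 x.2 v := by
    intro v
    rcases hcov v with ⟨i, hi⟩ | ⟨i, j, hj, rfl⟩
    · exact ⟨(i, 0), by simp [lvl, hi]⟩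
    · rcases Nat.eq_zero_or_pos j with rfl | hp
      · exact ⟨(i, 0), by simp [lvl, h0]⟩
      · exact ⟨(i, j), by simp [lvl, hj, hp]⟩
  choose c hc using hex
  have hu : ∀ i j i' j' v, lvl i j v → lvl i' j' v → j = j' ∧ (i = i' ∨ j = 2 * ℓ + 2) := by
    rintro i j i' j' v ⟨hj, h1⟩ ⟨hj', h2⟩
    rcases h1 with ⟨rfl, h1⟩ | ⟨h1p, rfl⟩ <;> rcases h2 with ⟨rfl, h2⟩ | ⟨h2p, h2⟩
    · exact ⟨rfl, Or.inl (hd _ _ _ h1 h2)⟩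
    · subst h2; exact absurd h1 (hnot _ _ h2p hj' _)
    · exact absurd h2 (hnot _ _ h1p hj _)
    · rcases Nat.lt_or_ge j (2 * ℓ + 2) with hl | hl
      · rcases Nat.lt_or_ge j' (2 * ℓ + 2) with hl' | hl'
        · have := hinj' _ _ _ _ hl hl' h2
          exact ⟨this.2, Or.inl this.1⟩
        · have : j' = 2 * ℓ + 2 := by omega
          subst this
          exact absurd (h2.trans (htop _)) (hne _ _ (by omega))
      · have : j = 2 * ℓ + 2 := by omega
        subst this
        rcases Nat.lt_or_ge j' (2 * ℓ + 2) with hl' | hl'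
        · exact absurd (h2.symm.trans (htop _)) (hne _ _ (by omega))
        · exact ⟨by omega, Or.inr rfl⟩
  have hlP : ∀ i j, j ≤ 2 * ℓ + 2 → lvl i j (P i j) := by
    intro i j hj
    rcases Nat.eq_zero_or_pos j with rfl | hp
    · simp [lvl, h0]
    · simp [lvl, hj, hp]
  have hlS : ∀ i v, v ∈ S i → lvl i 0 v := fun i v hv => by simp [lvl, hv]
  have hz : ∀ i v, v ∈ S i → (c v).2 = 0 ∧ (c v).1 = i := by
    intro i v hv
    have := hu _ _ _ _ _ (hc v) (hlS i v hv)
    refine ⟨this.1, this.2.resolve_right ?_⟩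
    omega
  refine ⟨S, P, q, fun v => (c v).2, fun v => (c v).1, ⟨?_, fun v => (hc v).1, by omega, ?_, ?_, ?_,
    htop, fun i j => hadj i j, ?_⟩, hfam⟩
  · refine fun i v => ⟨hz i v, ?_⟩
    rintro ⟨h1, rfl⟩
    rcases (hc v).2 with h2 | h2
    · exact h2.2
    · exact absurd h1 h2.1.ne'
  · exact fun i j hj => (hu _ _ _ _ _ (hc _) (hlP i j hj)).1
  · intro i j hj
    have := hu _ _ _ _ _ (hc _) (hlP i j hj.le)
    refine this.2.resolve_right ?_
    omega
  · intro v hv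
    exact ((hc v).2.resolve_left fun h => absurd h.1 hv.ne').2
  · intro x y hxy
    rcases hcase x y hxy with ⟨i, hx, hy⟩ | h
    · exact Or.inl ⟨(hz i x hx).1, (hz i y hy).1, (hz i x hx).2.trans (hz i y hy).2.symm⟩
    · exact Or.inr h

namespace IsTripod

variable {G : SimpleGraph V} {L : ℕ} {S : Fin 3 → Set V} {P : Fin 3 → ℕ → V} {q : V}
  {h : V → ℕ} {b : V → Fin 3}

theorem eq_top_iff (T : IsTripod G L S P q h b) (v : V) : h v = L ↔ v = q := by
  constructor
  · intro hv
    have := T.eq_path v (hv ▸ T.pos)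
    rw [hv, T.top] at this
    exact this
  · rintro rfl
    rw [← T.top 0, T.h_path 0 L le_rfl]

theorem root_mem (T : IsTripod G L S P q h b) (i : Fin 3) : P i 0 ∈ S i :=
  (T.mem_iff _ _).2 ⟨T.h_path _ _ (Nat.zero_le _), T.b_path _ _ T.pos⟩

theorem adj_height (T : IsTripod G L S P q h b) {x y : V} (hxy : G.Adj x y) :
    h x ≤ h y + 1 ∧ h y ≤ h x + 1 := by
  rcases T.adj_cases x y hxy with h1 | ⟨i, j, hj, ⟨rfl, rfl⟩ | ⟨rfl, rfl⟩⟩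
  · omega
  · rw [T.h_path i j (by omega), T.h_path i (j + 1) (by omega)]; omega
  · rw [T.h_path i j (by omega), T.h_path i (j + 1) (by omega)]; omega

theorem adj_branch (T : IsTripod G L S P q h b) {x y : V} (hxy : G.Adj x y) (hx : x ≠ q)
    (hy : y ≠ q) : b x = b y := by
  rcases T.adj_cases x y hxy with h1 | ⟨i, j, hj, ⟨rfl, rfl⟩ | ⟨rfl, rfl⟩⟩
  · exact h1.2.2
  · have : j + 1 ≠ L := fun e => hy (by rw [e, T.top])
    rw [T.b_path _ _ hj, T.b_path _ _ (by omega)]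
  · have : j + 1 ≠ L := fun e => hx (by rw [e, T.top])
    rw [T.b_path _ _ hj, T.b_path _ _ (by omega)]

theorem eq_root_of_adj (T : IsTripod G L S P q h b) {i : Fin 3} {x y : V} (hxy : G.Adj x y)
    (hx : x ∈ S i) (hy : y ∉ S i) : x = P i 0 := by
  rw [T.mem_iff] at hx hy
  rcases T.adj_cases x y hxy with h1 | ⟨i', j, hj, ⟨rfl, rfl⟩ | ⟨rfl, rfl⟩⟩
  · grind
  · rw [T.h_path _ _ hj.le, T.b_path _ _ hj] at hx
    rw [hx.1, hx.2]
  · rw [T.h_path _ _ hj] at hx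
    omega

theorem preconnected (T : IsTripod G L S P q h b)
    (hS : ∀ i, (G.induce (S i)).Preconnected) : G.Preconnected := by
  have h1 : ∀ i n, n ≤ L → G.Reachable (P i (L - n)) q := by
    intro i n
    induction n with
    | zero => intro _; rw [Nat.sub_zero, T.top]
    | succ n ih =>
      intro hn
      have := T.adj_path i (L - (n + 1)) (by omega)
      rw [show L - (n + 1) + 1 = L - n by omega] at this
      exact this.reachable.trans (ih (by omega))
  have h2 : ∀ i j, j ≤ L → G.Reachable (P i j) q := by
    intro i j hj
    have := h1 i (L - j) (by omega)
    rwa [Nat.sub_sub_self hj] at this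
  have h3 : ∀ v, G.Reachable v q := by
    intro v
    rcases Nat.eq_zero_or_pos (h v) with h0 | hp
    · have hv : v ∈ S (b v) := (T.mem_iff _ _).2 ⟨h0, rfl⟩
      have := (hS (b v) ⟨v, hv⟩ ⟨_, T.root_mem _⟩).map
        (SimpleGraph.Embedding.induce (G := G) (S (b v))).toHom
      exact SimpleGraph.Reachable.trans this (h2 _ 0 (Nat.zero_le _))
    · rw [T.eq_path v hp]
      exact h2 _ _ (T.le v)
  exact fun x y => (h3 x).trans (h3 y).symm

end IsTripod

theorem preconnected_of_inFam {ℓ : ℕ} : ∀ (k : ℕ) {V : Type u} {G : SimpleGraph V},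
    InFam ℓ k V G → G.Preconnected
  | 0, _, _, hG => hG.elim
  | 1, _, _, hG => fun x y => by rw [hG.2 x y]
  | k + 2, _, _, hG => by
    obtain ⟨S, P, q, h, b, T, hS⟩ := exists_isTripod hG
    exact T.preconnected fun i => preconnected_of_inFam (k + 1) (hS i)

/-- A map that contracts or preserves every edge does not increase distances. -/
theorem dist_map_le {G : SimpleGraph V} {H : SimpleGraph W} (f : V → W)
    (hf : ∀ x y, G.Adj x y → f x = f y ∨ H.Adj (f x) (f y)) {x y : V} (hxy : G.Reachable x y) :
    H.dist (f x) (f y) ≤ G.dist x y := by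
  obtain ⟨w, hw⟩ := hxy.exists_walk_length_eq_dist
  have : ∀ {x y : V} (w : G.Walk x y), ∃ w' : H.Walk (f x) (f y), w'.length ≤ w.length := by
    intro x y w
    induction w with
    | nil => exact ⟨.nil, le_rfl⟩
    | cons hadj w ih =>
      obtain ⟨w', hw'⟩ := ih
      rcases hf _ _ hadj with he | ha
      · rw [he]
        exact ⟨w', by simp only [SimpleGraph.Walk.length_cons]; omega⟩
      · exact ⟨.cons ha w', by simp only [SimpleGraph.Walk.length_cons]; omega⟩
  obtain ⟨w', hw'⟩ := this w
  exact (SimpleGraph.dist_le w').trans (hw'.trans hw.le)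

theorem sub_le_dist {G : SimpleGraph V} (f : V → ℤ) (hf : ∀ x y, G.Adj x y → f y - f x ≤ 1)
    {x y : V} (hxy : G.Reachable x y) : f y - f x ≤ G.dist x y := by
  obtain ⟨w, hw⟩ := hxy.exists_walk_length_eq_dist
  rw [← hw]
  clear hw hxy
  induction w with
  | nil => simp
  | cons hadj w ih =>
    have := hf _ _ hadj
    simp only [SimpleGraph.Walk.length_cons]
    push_cast
    omega

/-- A robber walking through permitted positions `Ok n` can be rerouted to start at `q`, provided
that every position at distance at least `n` from `q` is permitted at time `n`. -/
theorem exists_run_to {G : SimpleGraph V} {B : Set V} {q : V} {Ok : ℕ → Set V} {X : ℕ → V}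
    (hq : ∀ v ∈ B, G.dist v q = 0 → v = q)
    (hdown : ∀ v ∈ B, ∀ n, G.dist v q = n + 1 → ∃ w ∈ B, G.Adj w v ∧ G.dist w q = n)
    (hlip : ∀ x y, G.Adj x y → G.dist x q ≤ G.dist y q + 1)
    (hok : ∀ n, ∀ v ∈ B, n ≤ G.dist v q → v ∈ Ok n) :
    ∀ (M : ℕ) (w : V), (∀ n ≤ M, X n ∈ B ∧ X n ∈ Ok n) →
      (∀ n < M, X (n + 1) = X n ∨ G.Adj (X n) (X (n + 1))) → w ∈ B →
      (G.dist w q = M ∨ w = X M ∧ G.dist w q ≤ M) →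
      ∃ Y : ℕ → V, Y 0 = q ∧ Y M = w ∧ (∀ n ≤ M, Y n ∈ B ∧ Y n ∈ Ok n) ∧
        ∀ n < M, Y (n + 1) = Y n ∨ G.Adj (Y n) (Y (n + 1)) := by
  intro M
  induction M with
  | zero =>
    intro w hX hXw hw hd
    have hw0 : G.dist w q = 0 := by omega
    refine ⟨fun _ => w, hq w hw hw0, rfl, fun n hn => ⟨hw, hok n w hw (by omega)⟩, by simp⟩
  | succ M ih =>
    intro w hX hXw hw hd
    have key : ∀ v ∈ B, w ∈ Ok (M + 1) → (w = v ∨ G.Adj v w) →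
        (G.dist v q = M ∨ v = X M ∧ G.dist v q ≤ M) →
        ∃ Y : ℕ → V, Y 0 = q ∧ Y (M + 1) = w ∧ (∀ n ≤ M + 1, Y n ∈ B ∧ Y n ∈ Ok n) ∧
        ∀ n < M + 1, Y (n + 1) = Y n ∨ G.Adj (Y n) (Y (n + 1)) := by
      intro v hv hwok hvw hdv
      obtain ⟨Y, h0, hM, hB, hstep⟩ := ih v (fun n hn => hX n (by omega))
        (fun n hn => hXw n (by omega)) hv hdv
      refine ⟨fun n => if n ≤ M then Y n else w, by simp [h0], by simp, ?_, ?_⟩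
      · intro n hn
        by_cases hnM : n ≤ M
        · simpa [hnM] using hB n hnM
        · obtain rfl : n = M + 1 := by omega
          simpa using ⟨hw, hwok⟩
      · intro n hn
        by_cases hnM : n + 1 ≤ M
        · simpa [hnM, show n ≤ M by omega] using hstep n (by omega)
        · obtain rfl : n = M := by omega
          simpa [hM] using hvw
    have hfar : G.dist w q = M + 1 → ∃ Y : ℕ → V, Y 0 = q ∧ Y (M + 1) = w ∧
        (∀ n ≤ M + 1, Y n ∈ B ∧ Y n ∈ Ok n) ∧
        ∀ n < M + 1, Y (n + 1) = Y n ∨ G.Adj (Y n) (Y (n + 1)) := by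
      intro hd
      obtain ⟨v, hv, hvw, hdv⟩ := hdown w hw M hd
      exact key v hv (hok _ _ hw hd.ge) (Or.inr hvw) (Or.inl hdv)
    rcases hd with hd | ⟨rfl, hd⟩
    · exact hfar hd
    · by_cases hc : G.dist (X M) q ≤ M
      · exact key (X M) (hX M (by omega)).1 (hX (M + 1) le_rfl).2 (hXw M (by omega))
          (Or.inr ⟨rfl, hc⟩)
      · by_cases he : G.dist (X (M + 1)) q = M + 1
        · exact hfar he
        · refine key _ hw (hX _ le_rfl).2 (Or.inl rfl) (Or.inl ?_)
          rcases hXw M (by omega) with h1 | h1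
          · rw [h1] at hd he ⊢; omega
          · have := hlip _ _ h1
            omega

theorem exists_run {G : SimpleGraph V} {B : Set V} {q : V} {Ok : ℕ → Set V} {X : ℕ → V}
    (hq : ∀ v ∈ B, G.dist v q = 0 → v = q)
    (hdown : ∀ v ∈ B, ∀ n, G.dist v q = n + 1 → ∃ w ∈ B, G.Adj w v ∧ G.dist w q = n)
    (hlip : ∀ x y, G.Adj x y → G.dist x q ≤ G.dist y q + 1)
    (hok : ∀ n, ∀ v ∈ B, n ≤ G.dist v q → v ∈ Ok n) (M : ℕ)
    (hX : ∀ n ≤ M, X n ∈ B ∧ X n ∈ Ok n)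
    (hXw : ∀ n < M, X (n + 1) = X n ∨ G.Adj (X n) (X (n + 1))) :
    ∃ Y : ℕ → V, Y 0 = q ∧ (G.dist (X M) q ≤ M → Y M = X M) ∧
      (∀ n ≤ M, Y n ∈ B ∧ Y n ∈ Ok n) ∧
      ∀ n < M, Y (n + 1) = Y n ∨ G.Adj (Y n) (Y (n + 1)) := by
  by_cases hd : G.dist (X M) q ≤ M
  · obtain ⟨Y, h1, h2, h3⟩ := exists_run_to hq hdown hlip hok M (X M) hX hXw (hX M le_rfl).1
      (Or.inr ⟨rfl, hd⟩)
    exact ⟨Y, h1, fun _ => h2, h3⟩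
  · have : ∀ n, ∀ v ∈ B, G.dist v q = M + n → ∃ w ∈ B, G.dist w q = M := by
      intro n
      induction n with
      | zero => exact fun v hv h => ⟨v, hv, h⟩
      | succ n ih =>
        intro v hv h
        obtain ⟨w, hw, -, hwd⟩ := hdown v hv (M + n) h
        exact ih w hw hwd
    obtain ⟨w, hw, hwd⟩ := this (G.dist (X M) q - M) (X M) (hX M le_rfl).1 (by omega)
    obtain ⟨Y, h1, h2, h3⟩ := exists_run_to hq hdown hlip hok M w hX hXw hw (Or.inl hwd)
    exact ⟨Y, h1, fun h => absurd h hd, h3⟩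

end CopsRobber
namespace CopsRobber

variable {V : Type u}

/-- The cops follow the schedule `p`, where they may exchange their names at every step. -/
def IsSchedule (G : SimpleGraph V) {k : ℕ} (p : ℕ → Fin k → V) : Prop :=
  ∀ t, ∃ π : Equiv.Perm (Fin k), ∀ x, p (t + 1) x = p t (π x) ∨ G.Adj (p t (π x)) (p (t + 1) x)

/-- The vertex `v` is seen by no cop just before and just after the cop move following time `t`. -/
def Unseen (G : SimpleGraph V) (ℓ : ℕ) {k : ℕ} (p : ℕ → Fin k → V) (t : ℕ) (v : V) : Prop :=
  ∀ x, ℓ < G.dist (p t x) v ∧ ℓ < G.dist (p (t + 1) x) v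

/-- Against every schedule of `k` cops the robber can stay unseen arbitrarily long. -/
def Evades (G : SimpleGraph V) (ℓ k : ℕ) : Prop :=
  ∀ p : ℕ → Fin k → V, IsSchedule G p → ∀ N, ∃ R : ℕ → V,
    (∀ t < N, R (t + 1) = R t ∨ G.Adj (R t) (R (t + 1))) ∧ ∀ t ≤ N, Unseen G ℓ p t (R t)

namespace IsTripod

variable {G : SimpleGraph V} {ℓ k : ℕ} {S : Fin 3 → Set V} {P : Fin 3 → ℕ → V} {q : V}
  {h : V → ℕ} {b : V → Fin 3}

open Classical in
/-- The retraction of the whole graph onto `S j`. -/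
noncomputable def retract {L : ℕ} (T : IsTripod G L S P q h b) (j : Fin 3) (v : V) : S j :=
  if hv : v ∈ S j then ⟨v, hv⟩ else ⟨P j 0, T.root_mem j⟩

theorem retract_adj {L : ℕ} (T : IsTripod G L S P q h b) (j : Fin 3) {x y : V} (hxy : G.Adj x y) :
    T.retract j x = T.retract j y ∨ (G.induce (S j)).Adj (T.retract j x) (T.retract j y) := by
  unfold retract
  by_cases hx : x ∈ S j <;> by_cases hy : y ∈ S j
  · right; simpa [hx, hy] using hxy
  · left; simpa [hx, hy] using T.eq_root_of_adj hxy hx hy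
  · left; simpa [hx, hy] using (T.eq_root_of_adj hxy.symm hy hx).symm
  · left; simp [hx, hy]

theorem retract_eq_root {L : ℕ} (T : IsTripod G L S P q h b) (j : Fin 3) {x y : V} (hx : x ∉ S j)
    (hxy : x = y ∨ G.Adj x y) : T.retract j y = ⟨P j 0, T.root_mem j⟩ := by
  unfold retract
  by_cases hy : y ∈ S j
  · rcases hxy with rfl | hxy
    · exact absurd hy hx
    · simpa [hy] using T.eq_root_of_adj hxy.symm hy hx
  · simp [hy]

/-- If at every time some cop does not see into `S j`, then the others, retracted to `S j`, form a
schedule there, so the robber can stay unseen in `S j`. -/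
theorem exists_unseen_walk (T : IsTripod G (2 * ℓ + 2) S P q h b) (hc : G.Preconnected) (j : Fin 3)
    (ih : Evades (G.induce (S j)) ℓ k) (p : ℕ → Fin (k + 1) → V) (hp : IsSchedule G p) (N : ℕ)
    (hN : ∀ t ≤ N + 1, ∃ x, ¬ (b (p t x) = j ∧ h (p t x) ≤ ℓ)) :
    ∃ R : ℕ → V, (∀ t < N, R (t + 1) = R t ∨ G.Adj (R t) (R (t + 1))) ∧
      ∀ t ≤ N, R t ∈ S j ∧ Unseen G ℓ p t (R t) := by
  have hN' : ∀ t, ∃ x, ¬ (b (p (min t (N + 1)) x) = j ∧ h (p (min t (N + 1)) x) ≤ ℓ) :=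
    fun t => hN _ (min_le_right _ _)
  choose o ho using hN'
  have hoS : ∀ t, p (min t (N + 1)) (o t) ∉ S j := by
    intro t hm
    rw [T.mem_iff] at hm
    exact ho t ⟨hm.2, by omega⟩
  have hblind : ∀ t v, v ∈ S j → ℓ < G.dist (p (min t (N + 1)) (o t)) v := by
    intro t v hv
    have hlip := sub_le_dist (G := G)
      (fun v => if b v = j then -(h v : ℤ) else -(2 * ℓ + 2 : ℤ)) (by
        intro x y hxy
        have h1 := T.adj_height hxy
        have h2 := T.adj_branch hxy
        have h3 := T.eq_top_iff x
        have h4 := T.eq_top_iff y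
        have h5 := T.le x
        have h6 := T.le y
        split_ifs with hx hy hy
        · omega
        · have : x = q ∨ y = q := by
            by_contra hcon
            push Not at hcon
            exact hy ((h2 hcon.1 hcon.2).trans hx)
          rcases this with h7 | h7
          · have := h3.2 h7; omega
          · have := h4.2 h7; omega
        · have : x = q ∨ y = q := by
            by_contra hcon
            push Not at hcon
            exact hx ((h2 hcon.1 hcon.2).symm.trans hy)
          rcases this with h7 | h7
          · have := h3.2 h7; omega
          · have := h4.2 h7; omega
        · omega) (hc (p (min t (N + 1)) (o t)) v)
    have := ho t
    rw [T.mem_iff] at hv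
    simp only [hv.2, if_true, hv.1] at hlip
    split_ifs at hlip with hb
    · have : ℓ < h (p (min t (N + 1)) (o t)) := by
        by_contra hcon
        exact this ⟨hb, by omega⟩
      omega
    · omega
  have hp' : ∀ t, ∃ π : Equiv.Perm (Fin (k + 1)), ∀ x,
      p (min (t + 1) (N + 1)) x = p (min t (N + 1)) (π x) ∨
      G.Adj (p (min t (N + 1)) (π x)) (p (min (t + 1) (N + 1)) x) := by
    intro t
    rcases Nat.lt_or_ge t (N + 1) with ht | ht
    · rw [min_eq_left ht.le, min_eq_left (by omega : t + 1 ≤ N + 1)]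
      exact hp t
    · rw [min_eq_right ht, min_eq_right (by omega : N + 1 ≤ t + 1)]
      exact ⟨1, fun x => Or.inl rfl⟩
  let g : ℕ → Fin k → S j := fun t y => T.retract j (p (min t (N + 1)) ((o t).succAbove y))
  have hg : IsSchedule (G.induce (S j)) g := by
    intro t
    obtain ⟨π, hπ⟩ := hp' t
    have hτ : ∀ x, x ≠ o (t + 1) ↔ (Equiv.swap (o t) (π (o (t + 1))) * π : Equiv.Perm _) x ≠ o t := by
      intro x
      rw [Ne, Ne, Equiv.Perm.mul_apply, Equiv.swap_apply_eq_iff, Equiv.swap_apply_left,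
        π.injective.eq_iff]
    let ρ : Equiv.Perm (Fin k) := ((finSuccAboveEquiv (o (t + 1))).trans
      (Equiv.subtypeEquiv (Equiv.swap (o t) (π (o (t + 1))) * π) hτ)).trans
        (finSuccAboveEquiv (o t)).symm
    have hρ : ∀ y, (o t).succAbove (ρ y) =
        Equiv.swap (o t) (π (o (t + 1))) (π ((o (t + 1)).succAbove y)) := by
      intro y
      have : finSuccAboveEquiv (o t) (ρ y) =
        Equiv.subtypeEquiv (Equiv.swap (o t) (π (o (t + 1))) * π) hτ
          (finSuccAboveEquiv (o (t + 1)) y) := by simp [ρ]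
      simpa [finSuccAboveEquiv_apply] using congrArg Subtype.val this
    refine ⟨ρ, fun y => ?_⟩
    simp only [g]
    rw [hρ]
    set x := (o (t + 1)).succAbove y with hx
    have hxne : x ≠ o (t + 1) := Fin.succAbove_ne _ _
    by_cases hxo : π x = o t
    · left
      rw [hxo, Equiv.swap_apply_left]
      rw [T.retract_eq_root j (hoS t) (by have := hπ x; rw [hxo] at this; tauto)]
      rw [T.retract_eq_root j (hoS (t + 1))
        (by have := hπ (o (t + 1)); rw [G.adj_comm] at this; exact this)]
    · rw [Equiv.swap_apply_of_ne_of_ne hxo (fun e => hxne (π.injective e))]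
      rcases hπ x with h1 | h1
      · left; rw [h1]
      · rcases T.retract_adj j h1 with h2 | h2
        · exact Or.inl h2.symm
        · exact Or.inr h2
  obtain ⟨R, hR, hRu⟩ := ih g hg N
  have hsee : ∀ t v, (∀ y, ℓ < (G.induce (S j)).dist (g t y) v) →
      ∀ x, ℓ < G.dist (p (min t (N + 1)) x) v := by
    intro t v hv x
    by_cases hx : x = o t
    · subst hx; exact hblind t v v.2
    · obtain ⟨y, rfl⟩ := Fin.exists_succAbove_eq hx
      have h1 := dist_map_le (T.retract j) (fun x y hxy => T.retract_adj j hxy)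
        (hc (p (min t (N + 1)) ((o t).succAbove y)) v)
      have h2 : T.retract j v = v := by simp [retract]
      rw [h2] at h1
      exact (hv y).trans_le h1
  refine ⟨fun t => R t, fun t ht => ?_, fun t ht => ⟨(R t).2, fun x => ⟨?_, ?_⟩⟩⟩
  · rcases hR t ht with h1 | h1
    · left; exact congrArg Subtype.val h1
    · right; simpa using h1
  · have := hsee t (R t) (fun y => (hRu t ht y).1) x
    rwa [min_eq_left (by omega)] at this
  · have := hsee (t + 1) (R t) (fun y => (hRu t ht y).2) x
    rwa [min_eq_left (by omega)] at this

/-- If all cops are within distance `ℓ` of `S i` at time `τ`, then around time `τ` they do not see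
far into another branch. -/
theorem lt_dist_of_near (T : IsTripod G (2 * ℓ + 2) S P q h b) (hc : G.Preconnected)
    {p : ℕ → Fin (k + 1) → V} (hp : IsSchedule G p) {i j : Fin 3} (hij : i ≠ j) {τ : ℕ}
    (hτ : ∀ x, b (p τ x) = i ∧ h (p τ x) ≤ ℓ) {v : V} (hv : b v = j ∨ v = q) {n s : ℕ}
    (hn : n ≤ G.dist v q) (hs : s ≤ τ + n + 1) (hs' : τ ≤ s + n + 1) (x : Fin (k + 1)) :
    ℓ < G.dist (p s x) v := by
  classical
  let φ : V → ℤ := fun v => if b v = j ∨ v = q then (G.dist v q : ℤ) else h v - (2 * ℓ + 2)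
  have hdist : ∀ x y, G.Adj x y → G.dist y q ≤ G.dist x q + 1 := by
    intro x y hxy
    have h1 : G.dist y x ≤ 1 := by simpa using G.dist_le (.cons hxy.symm .nil)
    have := (hc y x).dist_triangle_left q
    omega
  have hone : ∀ x y, G.Adj x y → φ y - φ x ≤ 1 := by
    intro x y hxy
    have h1 := T.adj_height hxy
    have h2 := T.adj_branch hxy
    have h3 := T.eq_top_iff x
    have h4 := T.eq_top_iff y
    have h5 := T.le x
    have h6 := T.le y
    have h7 := hdist _ _ hxy
    simp only [φ]
    split_ifs with hy hx hx
    · omega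
    · have hyq : y = q := by
        by_contra hyq
        grind
      have := h4.2 hyq
      rw [hyq, SimpleGraph.dist_self]
      omega
    · omega
    · omega
  have hbase : ∀ x, φ (p τ x) ≤ -(ℓ + 2) := by
    intro x
    have h1 := T.eq_top_iff (p τ x)
    have h2 := hτ x
    have h3 : ¬ (b (p τ x) = j ∨ p τ x = q) := by
      rintro (h4 | h4)
      · exact hij (h2.1.symm.trans h4)
      · have := h1.2 h4; omega
    simp only [φ, if_neg h3]
    omega
  have hfwd : ∀ m, ∀ x, φ (p (τ + m) x) ≤ -(ℓ + 2) + m := by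
    intro m
    induction m with
    | zero => simpa using hbase
    | succ m ih =>
      intro x
      obtain ⟨π, hπ⟩ := hp (τ + m)
      have h1 := ih (π x)
      rcases hπ x with h2 | h2
      · rw [← add_assoc, h2]; push_cast; omega
      · have := hone _ _ h2
        rw [← add_assoc]; push_cast; omega
  have hbwd : ∀ m ≤ τ, ∀ x, φ (p (τ - m) x) ≤ -(ℓ + 2) + m := by
    intro m
    induction m with
    | zero => simpa using hbase
    | succ m ih =>
      intro hm x
      obtain ⟨π, hπ⟩ := hp (τ - (m + 1))
      rw [show τ - (m + 1) + 1 = τ - m by omega] at hπ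
      have h1 := ih (by omega) (π.symm x)
      have h2 := hπ (π.symm x)
      rw [Equiv.apply_symm_apply] at h2
      rcases h2 with h2 | h2
      · rw [← h2]; push_cast; omega
      · have := hone _ _ h2.symm
        push_cast; omega
  have hcop : φ (p s x) ≤ -(ℓ + 2) + (n + 1) := by
    rcases le_total τ s with hle | hle
    · have := hfwd (s - τ) x
      rw [show τ + (s - τ) = s by omega] at this
      omega
    · have := hbwd (τ - s) (by omega) x
      rw [show τ - (τ - s) = s by omega] at this
      omega
  have h1 := sub_le_dist φ hone (hc (p s x) v)
  have h2 : φ v = G.dist v q := by simp only [φ, if_pos hv]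
  omega

theorem exists_adj_dist (T : IsTripod G (2 * ℓ + 2) S P q h b) (hc : G.Preconnected) (j : Fin 3)
    (v : V) (hv : b v = j ∨ v = q) (n : ℕ) (hn : G.dist v q = n + 1) :
    ∃ w, (b w = j ∨ w = q) ∧ G.Adj w v ∧ G.dist w q = n := by
  obtain ⟨w, hw⟩ := (hc v q).exists_walk_length_eq_dist
  cases w with
  | nil => simp at hn
  | @cons _ w _ hadj w' =>
    refine ⟨w, ?_, hadj.symm, ?_⟩
    · have hvq : v ≠ q := by rintro rfl; simp at hn
      have := T.adj_branch hadj hvq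
      grind
    · have h1 := G.dist_le w'
      have h2 : G.dist v w ≤ 1 := by simpa using G.dist_le (.cons hadj .nil)
      have h3 := (hc v w).dist_triangle_left q
      simp only [SimpleGraph.Walk.length_cons] at hw
      omega

theorem exists_run_of_ok (T : IsTripod G (2 * ℓ + 2) S P q h b) (hc : G.Preconnected) (j : Fin 3)
    {Ok : ℕ → Set V} {X : ℕ → V}
    (hok : ∀ n, ∀ v, (b v = j ∨ v = q) → n ≤ G.dist v q → v ∈ Ok n) (M : ℕ)
    (hX : ∀ n ≤ M, (b (X n) = j ∨ X n = q) ∧ X n ∈ Ok n)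
    (hXw : ∀ n < M, X (n + 1) = X n ∨ G.Adj (X n) (X (n + 1))) :
    ∃ Y : ℕ → V, Y 0 = q ∧ (G.dist (X M) q ≤ M → Y M = X M) ∧
      (∀ n ≤ M, (b (Y n) = j ∨ Y n = q) ∧ Y n ∈ Ok n) ∧
      ∀ n < M, Y (n + 1) = Y n ∨ G.Adj (Y n) (Y (n + 1)) := by
  refine exists_run (B := {v | b v = j ∨ v = q}) ?_ ?_ ?_ hok M hX hXw
  · exact fun v _ hv => (hc v q).dist_eq_zero_iff.1 hv
  · exact fun v hv n hn => T.exists_adj_dist hc j v hv n hn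
  · intro x y hxy
    have h1 : G.dist x y ≤ 1 := by simpa using G.dist_le (.cons hxy .nil)
    have := (hc x y).dist_triangle_left q
    omega

/-- Between two times `a` and `c + 1` at which all cops are in another branch, the robber can move
unseen from `q` to `q`. -/
theorem exists_unseen_segment (T : IsTripod G (2 * ℓ + 2) S P q h b) (hc : G.Preconnected)
    (j : Fin 3) (ih : Evades (G.induce (S j)) ℓ k) (p : ℕ → Fin (k + 1) → V) (hp : IsSchedule G p)
    (a m : ℕ) (hN : ∀ t, a ≤ t → t ≤ a + m + 1 → ∃ x, ¬ (b (p t x) = j ∧ h (p t x) ≤ ℓ)) :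
    ∃ X : ℕ → V, (∀ n < m, X (n + 1) = X n ∨ G.Adj (X n) (X (n + 1))) ∧
      (∀ n ≤ m, Unseen G ℓ p (a + n) (X n)) ∧
      (∀ i, (∀ x, b (p a x) = i ∧ h (p a x) ≤ ℓ) → X 0 = q) ∧
      ∀ i, (∀ x, b (p (a + m + 1) x) = i ∧ h (p (a + m + 1) x) ≤ ℓ) → X m = q := by
  obtain ⟨X₀, hX₀, hu₀⟩ := T.exists_unseen_walk hc j ih (fun t => p (a + t)) (fun t => hp (a + t)) m
    (fun t ht => hN _ (by omega) (by omega))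
  have hne : ∀ t i, a ≤ t → t ≤ a + m + 1 → (∀ x, b (p t x) = i ∧ h (p t x) ≤ ℓ) → i ≠ j := by
    rintro t i h1 h2 h3 rfl
    obtain ⟨x, hx⟩ := hN t h1 h2
    exact hx (h3 x)
  obtain ⟨X₁, hX₁, hu₁, hq₁⟩ : ∃ X : ℕ → V, (∀ n < m, X (n + 1) = X n ∨ G.Adj (X n) (X (n + 1))) ∧
      (∀ n ≤ m, (b (X n) = j ∨ X n = q) ∧ Unseen G ℓ p (a + n) (X n)) ∧
      (∀ i, (∀ x, b (p a x) = i ∧ h (p a x) ≤ ℓ) → X 0 = q) := by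
    by_cases hcon : ∃ i, ∀ x, b (p a x) = i ∧ h (p a x) ≤ ℓ
    · obtain ⟨i, hi⟩ := hcon
      obtain ⟨Y, h1, -, h2, h3⟩ := T.exists_run_of_ok hc j
        (Ok := fun n => {v | Unseen G ℓ p (a + n) v}) (X := X₀) (by
          intro n v hv hn x
          have := hne a i (by omega) (by omega) hi
          exact ⟨T.lt_dist_of_near hc hp this hi hv hn (by omega) (by omega) x,
            T.lt_dist_of_near hc hp this hi hv hn (by omega) (by omega) x⟩) m
        (fun n hn => ⟨Or.inl ((T.mem_iff _ _).1 (hu₀ n hn).1).2, (hu₀ n hn).2⟩) hX₀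
      exact ⟨Y, h3, h2, fun _ _ => h1⟩
    · exact ⟨X₀, hX₀, fun n hn => ⟨Or.inl ((T.mem_iff _ _).1 (hu₀ n hn).1).2, (hu₀ n hn).2⟩,
        fun i hi => absurd ⟨i, hi⟩ hcon⟩
  by_cases hcon : ∃ i, ∀ x, b (p (a + m + 1) x) = i ∧ h (p (a + m + 1) x) ≤ ℓ
  · obtain ⟨i, hi⟩ := hcon
    obtain ⟨Y, h1, h2, h3, h4⟩ := T.exists_run_of_ok hc j
      (Ok := fun n => {v | n ≤ m → Unseen G ℓ p (a + m - n) v}) (X := fun n => X₁ (m - n)) (by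
        intro n v hv hn hnm x
        have := hne (a + m + 1) i (by omega) (by omega) hi
        exact ⟨T.lt_dist_of_near hc hp this hi hv hn (by omega) (by omega) x,
          T.lt_dist_of_near hc hp this hi hv hn (by omega) (by omega) x⟩) m
      (fun n hn => ⟨(hu₁ _ (by omega)).1, fun _ => by
        have := (hu₁ (m - n) (by omega)).2
        rwa [show a + (m - n) = a + m - n by omega] at this⟩)
      (fun n hn => by
        have := hX₁ (m - (n + 1)) (by omega)
        rw [show m - (n + 1) + 1 = m - n by omega] at this
        rw [G.adj_comm]
        tauto)
    refine ⟨fun n => Y (m - n), fun n hn => ?_, fun n hn => ?_, fun i' hi' => ?_, fun _ _ => ?_⟩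
    · have := h4 (m - (n + 1)) (by omega)
      rw [show m - (n + 1) + 1 = m - n by omega] at this
      rw [G.adj_comm]
      tauto
    · have := (h3 (m - n) (by omega)).2 (by omega)
      rwa [show a + m - (m - n) = a + n by omega] at this
    · have := hq₁ i' hi'
      rw [Nat.sub_self, this, SimpleGraph.dist_self] at h2
      simpa using h2 (Nat.zero_le _)
    · simpa using h1
  · exact ⟨X₁, hX₁, fun n hn => (hu₁ n hn).2, hq₁, fun i hi => absurd ⟨i, hi⟩ hcon⟩

theorem evades (T : IsTripod G (2 * ℓ + 2) S P q h b) (hc : G.Preconnected)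
    (ih : ∀ j, Evades (G.induce (S j)) ℓ k) : Evades G ℓ (k + 1) := by
  intro p hp
  have hthird : ∀ i i' : Fin 3, ∃ j, j ≠ i ∧ j ≠ i' := by decide
  have main : ∀ N, ∃ R : ℕ → V, (∀ t < N, R (t + 1) = R t ∨ G.Adj (R t) (R (t + 1))) ∧
      (∀ t < N, Unseen G ℓ p t (R t)) ∧
      ∀ i, (∀ x, b (p N x) = i ∧ h (p N x) ≤ ℓ) → R N = q := by
    intro N
    induction N using Nat.strong_induction_on with
    | _ N ihN =>
    have hlab : ∃ i', ∀ i, (∀ x, b (p N x) = i ∧ h (p N x) ≤ ℓ) → i = i' :=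
      ⟨b (p N 0), fun i hi => (hi 0).1.symm⟩
    obtain ⟨i', hi'⟩ := hlab
    rcases N with _ | c
    · exact ⟨fun _ => q, by simp, by simp, fun _ _ => rfl⟩
    obtain ⟨a, R₀, j, hac, hR₀, hu₀, hfree, hja⟩ : ∃ (a : ℕ) (R₀ : ℕ → V) (j : Fin 3), a ≤ c ∧
        (∀ t < a, R₀ (t + 1) = R₀ t ∨ G.Adj (R₀ t) (R₀ (t + 1))) ∧
        (∀ t < a, Unseen G ℓ p t (R₀ t)) ∧
        (∀ t, a ≤ t → t ≤ c + 1 → ∃ x, ¬ (b (p t x) = j ∧ h (p t x) ≤ ℓ)) ∧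
        (0 < a → R₀ a = q ∧ ∃ i, ∀ x, b (p a x) = i ∧ h (p a x) ≤ ℓ) := by
      classical
      by_cases hcon : ∃ a ≤ c, ∃ i, ∀ x, b (p a x) = i ∧ h (p a x) ≤ ℓ
      · obtain ⟨a₀, ha₀, hi₀⟩ := hcon
        let Q : ℕ → Prop := fun a => ∃ i, ∀ x, b (p a x) = i ∧ h (p a x) ≤ ℓ
        have hQ : Q (Nat.findGreatest Q c) := Nat.findGreatest_spec ha₀ hi₀
        have hlast : ∀ t, Nat.findGreatest Q c < t → t ≤ c → ¬ Q t :=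
          fun t => Nat.findGreatest_is_greatest
        have hle : Nat.findGreatest Q c ≤ c := Nat.findGreatest_le c
        generalize Nat.findGreatest Q c = a at hQ hlast hle
        obtain ⟨i, hi⟩ := hQ
        obtain ⟨j, hj, hj'⟩ := hthird i i'
        obtain ⟨R₀, h1, h2, h3⟩ := ihN a (by omega)
        refine ⟨a, R₀, j, hle, h1, h2, fun t ht ht' => ?_, fun _ => ⟨h3 i hi, i, hi⟩⟩
        by_contra! hcon
        rcases Nat.lt_or_ge a t with hat | hat
        · rcases Nat.lt_or_ge c t with hct | hct
          · obtain rfl : t = c + 1 := by omega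
            exact hj' (hi' j hcon)
          · exact hlast t hat hct ⟨j, hcon⟩
        · obtain rfl : t = a := by omega
          exact hj ((hcon 0).1.symm.trans (hi 0).1)
      · obtain ⟨j, hj, -⟩ := hthird i' i'
        refine ⟨0, fun _ => q, j, by omega, by simp, by simp, fun t ht ht' => ?_, by simp⟩
        by_contra! hcon'
        rcases Nat.lt_or_ge c t with hct | hct
        · obtain rfl : t = c + 1 := by omega
          exact hj (hi' j hcon')
        · exact hcon ⟨t, hct, j, hcon'⟩
    obtain ⟨m, rfl⟩ := Nat.exists_eq_add_of_le hac
    obtain ⟨X, hX, hu, hq, hq'⟩ := T.exists_unseen_segment hc j (ih j) p hp a m hfree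
    have hglue : 0 < a → R₀ a = X 0 := by
      intro h0
      obtain ⟨h1, i, hi⟩ := hja h0
      rw [h1, hq i hi]
    refine ⟨fun t => if t < a then R₀ t else X (min (t - a) m), fun t ht => ?_, fun t ht => ?_,
      fun i hi => ?_⟩
    · simp only
      rcases Nat.lt_trichotomy (t + 1) a with h1 | h1 | h1
      · rw [if_pos h1, if_pos (by omega)]
        exact hR₀ t (by omega)
      · rw [if_neg (by omega), if_pos (by omega), ← h1, Nat.sub_self, Nat.zero_min,
          ← hglue (by omega), ← h1]
        exact hR₀ t (by omega)
      · rw [if_neg (by omega), if_neg (by omega)]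
        rcases Nat.lt_or_ge (t - a) m with h2 | h2
        · rw [min_eq_left h2.le, min_eq_left (by omega), show t + 1 - a = t - a + 1 by omega]
          exact hX _ h2
        · rw [min_eq_right h2, min_eq_right (by omega)]
          exact Or.inl rfl
    · simp only
      split_ifs with h1
      · exact hu₀ t h1
      · rw [min_eq_left (by omega)]
        have := hu (t - a) (by omega)
        rwa [show a + (t - a) = t by omega] at this
    · simp only
      rw [if_neg (by omega), min_eq_right (by omega)]
      exact hq' i hi
  intro N
  obtain ⟨R, h1, h2, -⟩ := main (N + 1)
  exact ⟨R, fun t ht => h1 t (by omega), fun t ht => h2 t (by omega)⟩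

end IsTripod

theorem evades_of_inFam {ℓ : ℕ} : ∀ (k : ℕ) {V : Type u} {G : SimpleGraph V},
    InFam ℓ (k + 1) V G → Evades G ℓ k
  | 0, _, _, hG => fun _ _ _ =>
    ⟨fun _ => hG.1.some, fun _ _ => Or.inl rfl, fun _ _ x => x.elim0⟩
  | k + 1, _, _, hG => by
    obtain ⟨S, P, q, h, b, T, hS⟩ := exists_isTripod hG
    exact T.evades (preconnected_of_inFam _ hG) fun j => evades_of_inFam k (hS j)

end CopsRobber
namespace CopsRobber

variable {V : Type u} {W : Type u}

/-- A schedule of `k` cops moving along edges. -/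
def IsLegal (G : SimpleGraph V) {k : ℕ} (p : ℕ → Fin k → V) : Prop :=
  ∀ t x, p (t + 1) x = p t x ∨ G.Adj (p t x) (p (t + 1) x)

/-- The robber `R` is captured around time `t`. -/
def CaughtAt {k : ℕ} (p : ℕ → Fin k → V) (R : ℕ → V) (t : ℕ) : Prop :=
  ∃ x, p t x = R t ∨ p (t + 1) x = R t

/-- Some schedule of `k` cops captures every robber who does not leave `A`. -/
def Sweepable (G : SimpleGraph V) (k : ℕ) (A : Set V) : Prop :=
  ∃ (N : ℕ) (p : ℕ → Fin k → V), IsLegal G p ∧ ∀ R, RobberWalk G R → (∀ t ≤ N, R t ∈ A) →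
    ∃ t < N, CaughtAt p R t

/-- Some schedule of `k + 1` cops brings the first cop to `x` while every robber who does not leave
`B` is either captured or at the end in `U`, or at `x`. -/
def Stage (G : SimpleGraph V) (k : ℕ) (B : Set V) (x : V) (U : Set V) : Prop :=
  ∃ (N : ℕ) (p : ℕ → Fin (k + 1) → V), IsLegal G p ∧ p N 0 = x ∧ ∀ R, RobberWalk G R →
    (∀ t ≤ N, R t ∈ B) → (∃ t < N, CaughtAt p R t) ∨ R N = x ∨ R N ∈ U

variable {G : SimpleGraph V} {k : ℕ} {A B : Set V}

theorem RobberWalk.shift {R : ℕ → V} (hR : RobberWalk G R) (N : ℕ) :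
    RobberWalk G fun t => R (N + t) := fun t => hR (N + t)

/-- Two schedules can be performed one after the other. -/
theorem exists_concat (hG : G.Preconnected) {p p' : ℕ → Fin k → V} (hp : IsLegal G p)
    (hp' : IsLegal G p') (N : ℕ) :
    ∃ (M : ℕ) (r : ℕ → Fin k → V), IsLegal G r ∧ (∀ t ≤ N, r t = p t) ∧
      ∀ t, r (N + M + t) = p' t := by
  have w : ∀ x, G.Walk (p N x) (p' 0 x) := fun x => (hG _ _).some
  have hwl : ∀ x, (w x).length ≤ ∑ y, (w y).length := fun x =>
    Finset.single_le_sum (f := fun y => (w y).length) (fun _ _ => Nat.zero_le _) (Finset.mem_univ x)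
  generalize ∑ y, (w y).length = M at hwl
  refine ⟨M, fun t x => if t ≤ N then p t x else if t ≤ N + M then (w x).getVert (t - N)
    else p' (t - (N + M)) x, ?_, fun t ht => by simp [ht], fun t => ?_⟩
  · intro t x
    rcases Nat.lt_trichotomy t N with h1 | rfl | h1
    · simpa [h1.le, Nat.succ_le_of_lt h1] using hp t x
    · rcases Nat.eq_zero_or_pos M with rfl | hM
      · have : p t x = p' 0 x := (w x).eq_of_length_eq_zero (Nat.le_zero.1 (hwl x))
        simpa [this] using hp' 0 x
      · rcases Nat.eq_zero_or_pos (w x).length with h0 | h0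
        · have h2 : p t x = p' 0 x := (w x).eq_of_length_eq_zero h0
          have h3 := (w x).getVert_of_length_le (i := 1) (by omega)
          left
          simp [h2, h3, hM.ne']
        · have := (w x).adj_getVert_succ h0
          right
          simpa [show 1 ≤ M from hM] using this
    · rcases Nat.lt_trichotomy t (N + M) with h2 | rfl | h2
      · simp only [if_neg (show ¬ t ≤ N by omega), if_neg (show ¬ t + 1 ≤ N by omega), if_pos h2.le,
          if_pos (show t + 1 ≤ N + M by omega), show t + 1 - N = t - N + 1 by omega]
        rcases Nat.lt_or_ge (t - N) (w x).length with h3 | h3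
        · exact Or.inr ((w x).adj_getVert_succ h3)
        · left
          rw [(w x).getVert_of_length_le h3, (w x).getVert_of_length_le (by omega)]
      · have h3 := (w x).getVert_of_length_le (hwl x)
        simp only [if_neg (show ¬ N + M ≤ N by omega), if_neg (show ¬ N + M + 1 ≤ N by omega),
          le_refl, if_true, if_neg (show ¬ N + M + 1 ≤ N + M by omega), Nat.add_sub_cancel_left, h3]
        exact hp' 0 x
      · simp only [if_neg (show ¬ t ≤ N by omega), if_neg (show ¬ t + 1 ≤ N by omega),
          if_neg (show ¬ t ≤ N + M by omega), if_neg (show ¬ t + 1 ≤ N + M by omega),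
          show t + 1 - (N + M) = t - (N + M) + 1 by omega]
        exact hp' _ x
  · funext x
    rcases Nat.eq_zero_or_pos t with rfl | ht
    · rcases Nat.eq_zero_or_pos M with rfl | hM
      · have : p N x = p' 0 x := (w x).eq_of_length_eq_zero (Nat.le_zero.1 (hwl x))
        simp [this]
      · simp [show ¬ N + M ≤ N by omega, (w x).getVert_of_length_le (hwl x)]
    · simp only [if_neg (show ¬ N + M + t ≤ N by omega), if_neg (show ¬ N + M + t ≤ N + M by omega),
        Nat.add_sub_cancel_left]

namespace Sweepable

theorem mono (hA : Sweepable G k A) (hBA : B ⊆ A) : Sweepable G k B := by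
  obtain ⟨N, p, hp, h⟩ := hA
  exact ⟨N, p, hp, fun R hR hB => h R hR fun t ht => hBA (hB t ht)⟩

theorem mono_cops [Nonempty V] (hA : Sweepable G k A) {k' : ℕ} (hk : k ≤ k') :
    Sweepable G k' A := by
  obtain ⟨N, p, hp, h⟩ := hA
  refine ⟨N, fun t x => if hx : x.1 < k then p t ⟨x, hx⟩ else Classical.arbitrary V, ?_, ?_⟩
  · intro t x
    by_cases hx : x.1 < k
    · simpa [hx] using hp t ⟨x, hx⟩
    · simp [hx]
  · intro R hR hRA
    obtain ⟨t, ht, x, hx⟩ := h R hR hRA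
    exact ⟨t, ht, ⟨x, by omega⟩, by simpa using hx⟩

theorem empty [Nonempty V] (G : SimpleGraph V) (k : ℕ) : Sweepable G k ∅ :=
  ⟨0, fun _ _ => Classical.arbitrary V, fun _ _ => Or.inl rfl,
    fun _ _ h => (h 0 le_rfl).elim⟩

theorem singleton (G : SimpleGraph V) (v : V) : Sweepable G 1 {v} :=
  ⟨1, fun _ _ => v, fun _ _ => Or.inl rfl,
    fun _ _ h => ⟨0, one_pos, 0, Or.inl (h 0 (Nat.zero_le _)).symm⟩⟩

theorem union (hG : G.Preconnected) (hA : Sweepable G k A) (hB : Sweepable G k B)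
    (hAB : ∀ u ∈ A, ∀ v ∈ B, ¬ G.Adj u v) : Sweepable G k (A ∪ B) := by
  obtain ⟨N, p, hp, h⟩ := hA
  obtain ⟨N', p', hp', h'⟩ := hB
  obtain ⟨M, r, hr, hrp, hrp'⟩ := exists_concat hG hp hp' (N + 1)
  refine ⟨N + 1 + M + N' + 1, r, hr, fun R hR hRAB => ?_⟩
  have hside : (∀ t ≤ N + 1 + M + N' + 1, R t ∈ A) ∨ ∀ t ≤ N + 1 + M + N' + 1, R t ∈ B := by
    rcases hRAB 0 (Nat.zero_le _) with h0 | h0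
    · left
      intro t
      induction t with
      | zero => exact fun _ => h0
      | succ t ih =>
        intro ht
        have h1 := ih (by omega)
        rcases hR t with h2 | h2
        · rwa [h2]
        · exact (hRAB _ ht).resolve_right fun h3 => hAB _ h1 _ h3 h2
    · right
      intro t
      induction t with
      | zero => exact fun _ => h0
      | succ t ih =>
        intro ht
        have h1 := ih (by omega)
        rcases hR t with h2 | h2
        · rwa [h2]
        · exact (hRAB _ ht).resolve_left fun h3 => hAB _ h3 _ h1 h2.symm
  rcases hside with hs | hs
  · obtain ⟨t, ht, x, hx⟩ := h R hR fun t ht => hs t (by omega)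
    refine ⟨t, by omega, x, ?_⟩
    rwa [hrp t (by omega), hrp (t + 1) (by omega)]
  · obtain ⟨t, ht, x, hx⟩ := h' _ (hR.shift (N + 1 + M)) fun t ht => hs _ (by omega)
    refine ⟨N + 1 + M + t, by omega, x, ?_⟩
    rwa [hrp' t, add_assoc _ t, hrp' (t + 1)]

end Sweepable

namespace Stage

variable {x y : V} {U U' A' : Set V}

theorem start (G : SimpleGraph V) (k : ℕ) (B : Set V) (x : V) : Stage G k B x B :=
  ⟨0, fun _ _ => x, fun _ _ => Or.inl rfl, rfl, fun _ _ h => Or.inr (Or.inr (h 0 le_rfl))⟩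

theorem mono (hs : Stage G k B x U) (hU : ∀ v ∈ B, v ∈ U → v = x ∨ v ∈ U') : Stage G k B x U' := by
  obtain ⟨N, p, hp, hx, h⟩ := hs
  refine ⟨N, p, hp, hx, fun R hR hB => ?_⟩
  rcases h R hR hB with h1 | h1 | h1
  · exact Or.inl h1
  · exact Or.inr (Or.inl h1)
  · exact Or.inr (hU _ (hB N le_rfl) h1)

theorem move (hs : Stage G k B x U) (hxy : G.Adj x y)
    (hU : ∀ u ∈ U, ∀ v ∈ B, G.Adj u v → v ∈ U ∨ v = x) (hy : ∀ v ∈ U, G.Adj x v → v = y) :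
    Stage G k B y (U \ {y}) := by
  obtain ⟨N, p, hp, hx, h⟩ := hs
  refine ⟨N + 1, fun t => if t ≤ N then p t else Function.update (p N) 0 y, ?_, by simp, ?_⟩
  · intro t z
    rcases Nat.lt_trichotomy t N with h1 | rfl | h1
    · simpa [h1.le, Nat.succ_le_of_lt h1] using hp t z
    · by_cases hz : z = 0
      · subst hz; right; simpa [hx] using hxy
      · left; simp [hz]
    · left
      simp only [if_neg (show ¬ t ≤ N by omega), if_neg (show ¬ t + 1 ≤ N by omega)]
  · intro R hR hB
    rcases h R hR (fun t ht => hB t (by omega)) with ⟨t, ht, z, hz⟩ | h1 | h1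
    · refine Or.inl ⟨t, by omega, z, ?_⟩
      simpa [ht.le, Nat.succ_le_of_lt ht] using hz
    · refine Or.inl ⟨N, by omega, 0, Or.inl ?_⟩
      simp [hx, h1]
    · by_cases hRy : R N = y
      · refine Or.inl ⟨N, by omega, 0, Or.inr ?_⟩
        simp [hRy]
      · right
        have h2 : R (N + 1) ∈ U := by
          rcases hR N with h2 | h2
          · rwa [h2]
          · refine (hU _ h1 _ (hB _ le_rfl) h2).resolve_right fun h3 => hRy ?_
            exact hy _ h1 (h3 ▸ h2.symm)
        by_cases h3 : R (N + 1) = y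
        · exact Or.inl h3
        · exact Or.inr ⟨h2, h3⟩

theorem sweep (hG : G.Preconnected) (hs : Stage G k B x U) (hA : Sweepable G k A)
    (hU : ∀ u ∈ U, ∀ v ∈ B, G.Adj u v → v ∈ U ∨ v = x)
    (hA' : ∀ u ∈ A, ∀ v ∈ B, G.Adj u v → v ∈ A ∨ v = x) : Stage G k B x (U \ A) := by
  obtain ⟨N, p, hp, hx, h⟩ := hs
  obtain ⟨N', p', hp', h'⟩ := hA
  obtain ⟨M, r, hr, hrp, hrp'⟩ :=
    exists_concat hG (p := fun t i => p t i.succ) (fun t i => hp t i.succ) hp' N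
  refine ⟨N + M + N' + 1, fun t => Fin.cons (p (min t N) 0) (r t), ?_, ?_, ?_⟩
  · intro t z
    refine Fin.cases ?_ (fun i => ?_) z
    · simp only [Fin.cons_zero]
      rcases Nat.lt_or_ge t N with h1 | h1
      · rw [min_eq_left h1.le, min_eq_left (by omega)]
        exact hp t 0
      · rw [min_eq_right h1, min_eq_right (by omega)]
        exact Or.inl rfl
    · simpa using hr t i
  · simp only [Fin.cons_zero]
    rwa [min_eq_right (by omega)]
  · intro R hR hB
    by_contra! hcon
    obtain ⟨hfree, hRx, hRU⟩ := hcon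
    have hne : ∀ t, N ≤ t → t < N + M + N' + 1 → R t ≠ x := by
      intro t h1 h2 h3
      refine hfree t h2 ⟨0, Or.inl ?_⟩
      simp only [Fin.cons_zero]
      rw [min_eq_right h1, hx, h3]
    have hN : R N ∈ U := by
      rcases h R hR (fun t ht => hB t (by omega)) with ⟨t, ht, z, hz⟩ | h1 | h1
      · refine absurd ⟨z, ?_⟩ (hfree t (by omega))
        revert hz
        refine Fin.cases ?_ (fun i => ?_) z
        · simp only [Fin.cons_zero]
          rw [min_eq_left ht.le, min_eq_left (by omega)]
          exact id
        · simp only [Fin.cons_succ]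
          rw [hrp t ht.le, hrp (t + 1) (by omega)]
          exact id
      · exact absurd h1 (hne N le_rfl (by omega))
      · exact h1
    have hne' : ∀ t, N ≤ t → t ≤ N + M + N' + 1 → R t ≠ x := by
      intro t h1 h2
      rcases Nat.lt_or_ge t (N + M + N' + 1) with h3 | h3
      · exact hne t h1 h3
      · obtain rfl : t = N + M + N' + 1 := by omega
        exact hRx
    have hUt : ∀ n, N + n ≤ N + M + N' + 1 → R (N + n) ∈ U := by
      intro n
      induction n with
      | zero => exact fun _ => hN
      | succ n ih =>
        intro hn
        have h1 := ih (by omega)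
        rcases hR (N + n) with h2 | h2
        · rw [← add_assoc, h2]; exact h1
        · exact (hU _ h1 _ (hB _ hn) h2).resolve_right (hne' _ (by omega) hn)
    have hend : R (N + M + N' + 1) ∈ A := by
      by_contra hA
      have := hUt (M + N' + 1) (by omega)
      rw [show N + (M + N' + 1) = N + M + N' + 1 by omega] at this
      exact hRU ⟨this, hA⟩
    have hAt : ∀ n, n ≤ M + N' + 1 → R (N + M + N' + 1 - n) ∈ A := by
      intro n
      induction n with
      | zero => exact fun _ => hend
      | succ n ih =>
        intro hn
        have h1 := ih (by omega)
        have h2 := hR (N + M + N' + 1 - (n + 1))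
        rw [show N + M + N' + 1 - (n + 1) + 1 = N + M + N' + 1 - n by omega] at h2
        rcases h2 with h2 | h2
        · rwa [← h2]
        · exact (hA' _ h1 _ (hB _ (by omega)) h2.symm).resolve_right (hne' _ (by omega) (by omega))
    obtain ⟨t, ht, i, hi⟩ := h' _ (hR.shift (N + M)) fun t ht => by
      have := hAt (N' + 1 - t) (by omega)
      rwa [show N + M + N' + 1 - (N' + 1 - t) = N + M + t by omega] at this
    refine hfree (N + M + t) (by omega) ⟨i.succ, ?_⟩
    simp only [Fin.cons_succ]
    rwa [hrp' t, add_assoc _ t, hrp' (t + 1)]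

theorem finish (hs : Stage G k B x ∅) : Sweepable G (k + 1) B := by
  obtain ⟨N, p, hp, hx, h⟩ := hs
  refine ⟨N + 1, p, hp, fun R hR hB => ?_⟩
  rcases h R hR (fun t ht => hB t (by omega)) with ⟨t, ht, hc⟩ | h1 | h1
  · exact ⟨t, by omega, hc⟩
  · exact ⟨N, by omega, 0, Or.inl (hx.trans h1.symm)⟩
  · exact h1.elim

end Stage

/-- One cop walks along a path `x 0, …, x m`, while the other `k` cops sweep the parts `E j` hanging
from it. -/
theorem sweepable_of_path (hG : G.Preconnected) (x : ℕ → V) (m : ℕ) (E : ℕ → Set V)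
    (hB : ∀ v ∈ B, ∃ j ≤ m, v ∈ E j) (hx : ∀ j ≤ m, x j ∈ E j)
    (hadj : ∀ j < m, G.Adj (x j) (x (j + 1)))
    (hedge : ∀ j j' u v, j < j' → j' ≤ m → u ∈ E j → v ∈ E j' → G.Adj u v →
      j' = j + 1 ∧ u = x j ∧ v = x j')
    (hsw : ∀ j ≤ m, Sweepable G k (E j \ {x j})) : Sweepable G (k + 1) B := by
  have hpiece : ∀ j ≤ m, ∀ u ∈ E j \ {x j}, ∀ v ∈ B, G.Adj u v → v ∈ E j \ {x j} ∨ v = x j := by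
    rintro j hj u ⟨hu, hux⟩ v hv huv
    obtain ⟨j', hj', hv'⟩ := hB v hv
    rcases Nat.lt_trichotomy j j' with h1 | rfl | h1
    · exact absurd (hedge j j' u v h1 hj' hu hv' huv).2.1 hux
    · by_cases h2 : v = x j
      · exact Or.inr h2
      · exact Or.inl ⟨hv', h2⟩
    · exact absurd (hedge j' j v u h1 hj hv' hu huv.symm).2.2 hux
  have hstage : ∀ j ≤ m, Stage G k B (x j) {v | ∃ j', j < j' ∧ j' ≤ m ∧ v ∈ E j'} := by
    intro j
    induction j with
    | zero =>
      intro _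
      refine ((Stage.start G k B (x 0)).sweep hG (hsw 0 (Nat.zero_le _))
        (fun _ _ v hv _ => Or.inl hv) (hpiece 0 (Nat.zero_le _))).mono ?_
      rintro v hv ⟨-, hv0⟩
      obtain ⟨j', hj', hv'⟩ := hB v hv
      rcases Nat.eq_zero_or_pos j' with rfl | h1
      · left
        by_contra h2
        exact hv0 ⟨hv', h2⟩
      · exact Or.inr ⟨j', h1, hj', hv'⟩
    | succ j ih =>
      intro hj
      have h1 := (ih (by omega)).move (hadj j (by omega)) ?_ ?_
      · refine (h1.sweep hG (hsw (j + 1) hj) ?_ (hpiece (j + 1) hj)).mono ?_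
        · rintro u ⟨⟨j', hj', hjm, hu⟩, hux⟩ v hv huv
          by_cases h2 : v = x (j + 1)
          · exact Or.inr h2
          refine Or.inl ⟨?_, h2⟩
          obtain ⟨j'', hj'', hv'⟩ := hB v hv
          rcases Nat.lt_or_ge j j'' with h3 | h3
          · exact ⟨j'', h3, hj'', hv'⟩
          · obtain ⟨h4, -, h5⟩ := hedge j'' j' v u (by omega) hjm hv' hu huv.symm
            obtain rfl : j' = j + 1 := by omega
            exact absurd h5 hux
        · rintro v - ⟨⟨⟨j', hj', hjm, hv⟩, hvx⟩, hvE⟩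
          rcases Nat.lt_or_ge (j + 1) j' with h2 | h2
          · exact Or.inr ⟨j', h2, hjm, hv⟩
          · obtain rfl : j' = j + 1 := by omega
            exact absurd ⟨hv, hvx⟩ hvE
      · rintro u ⟨j', hj', hjm, hu⟩ v hv huv
        obtain ⟨j'', hj'', hv'⟩ := hB v hv
        rcases Nat.lt_or_ge j j'' with h3 | h3
        · exact Or.inl ⟨j'', h3, hj'', hv'⟩
        · obtain ⟨h4, h5, -⟩ := hedge j'' j' v u (by omega) hjm hv' hu huv.symm
          obtain rfl : j'' = j := by omega
          exact Or.inr h5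
      · rintro v ⟨j', hj', hjm, hv⟩ hxv
        obtain ⟨h4, -, h5⟩ := hedge j j' (x j) v hj' hjm (hx j (by omega)) hv hxv
        rwa [h4] at h5
  exact ((hstage m le_rfl).mono (U' := ∅) (by rintro v - ⟨j', h1, h2, -⟩; omega)).finish

end CopsRobber
namespace CopsRobber

variable {V : Type u} {W : Type u}

/-- `k` cops sweep every copy of `G` together with an attachment `D` at a vertex `r`, provided that
one cop sweeps the attachment. -/
def SweepsAttached (G : SimpleGraph V) (k : ℕ) (A : Set V) {W : Type u} (H : SimpleGraph W)
    (f : G ↪g H) : Prop :=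
  ∀ r ∈ A, ∀ D : Set W, (∀ u ∈ D, ∀ v ∈ A, H.Adj u (f v) → v = r) →
    Sweepable H 1 (insert (f r) D) → Sweepable H k (f '' A ∪ D)

namespace IsTripod

variable {G : SimpleGraph V} {H : SimpleGraph W} {L k : ℕ} {S : Fin 3 → Set V} {P : Fin 3 → ℕ → V}
  {q : V} {h : V → ℕ} {b : V → Fin 3}

theorem sweepable_branch (T : IsTripod G L S P q h b) (hH : H.Preconnected) (f : G ↪g H) (i : Fin 3)
    (ih : SweepsAttached G (k + 1) (S i) H f) :
    Sweepable H (k + 1) (f '' {v | b v = i ∧ v ≠ q}) := by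
  have : Nonempty W := ⟨f q⟩
  have hL := T.pos
  refine (ih (P i 0) (T.root_mem i) {w | ∃ j, 0 < j ∧ j < L ∧ f (P i j) = w} ?_ ?_).mono ?_
  · rintro _ ⟨j, hj, hjL, rfl⟩ v hv ha
    refine T.eq_root_of_adj (f.map_adj_iff.1 ha).symm hv fun hm => ?_
    rw [T.mem_iff, T.h_path _ _ hjL.le] at hm
    omega
  · refine sweepable_of_path hH (fun j => f (P i j)) (L - 1) (fun j => {f (P i j)}) ?_
      (fun _ _ => rfl) (fun j hj => f.map_adj_iff.2 (T.adj_path i j (by omega))) ?_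
      (fun j _ => by simpa using Sweepable.empty H 0)
    · rintro _ (rfl | ⟨j, hj, hjL, rfl⟩)
      · exact ⟨0, Nat.zero_le _, rfl⟩
      · exact ⟨j, by omega, rfl⟩
    · rintro j j' _ _ hjj hj' rfl rfl ha
      have := T.adj_height (f.map_adj_iff.1 ha)
      rw [T.h_path _ _ (by omega), T.h_path _ _ (by omega)] at this
      exact ⟨by omega, rfl, rfl⟩
  · rintro _ ⟨v, ⟨hb, hv⟩, rfl⟩
    rcases Nat.eq_zero_or_pos (h v) with h0 | h0
    · exact Or.inl ⟨v, (T.mem_iff _ _).2 ⟨h0, hb⟩, rfl⟩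
    · refine Or.inr ⟨h v, h0, (T.le v).lt_of_ne fun e => hv ((T.eq_top_iff v).1 e), ?_⟩
      rw [← hb, ← T.eq_path v h0]

theorem sweepable (T : IsTripod G L S P q h b) (hH : H.Preconnected) (f : G ↪g H)
    (ih : ∀ i, SweepsAttached G (k + 1) (S i) H f) :
    SweepsAttached G (k + 2) Set.univ H f := by
  intro r _ D hD hDr
  have : Nonempty W := ⟨f q⟩
  have hL := T.pos
  obtain ⟨i, hi⟩ : ∃ i, b r = i := ⟨_, rfl⟩
  let E : ℕ → Set W := fun j => {w | (∃ v, (b v = i ∨ v = q) ∧ h v = j ∧ f v = w) ∨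
    (∃ v, b v ≠ i ∧ v ≠ q ∧ j = L ∧ f v = w) ∨ (w ∈ D ∧ j = h r)}
  have hDs : Sweepable H (k + 1) D :=
    (hDr.mono (Set.subset_insert _ _)).mono_cops (by omega)
  have hcase : ∀ j j' a c, j < j' → G.Adj a c →
      ((b a = i ∨ a = q) ∧ h a = j ∨ b a ≠ i ∧ a ≠ q ∧ j = L) →
      ((b c = i ∨ c = q) ∧ h c = j' ∨ b c ≠ i ∧ c ≠ q ∧ j' = L) → j' ≤ L →
      j' = j + 1 ∧ a = P i j ∧ c = P i j' := by
    intro j j' a c hjj hac ha hc hj'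
    have ha' : b a = i ∧ h a = j ∧ a ≠ q := by
      have := T.eq_top_iff a
      grind
    have hc' : (b c = i ∨ c = q) ∧ h c = j' := by
      have := T.adj_branch hac ha'.2.2
      grind
    have hh := T.adj_height hac
    refine ⟨by omega, ?_, ?_⟩
    · rcases Nat.eq_zero_or_pos j with h0 | h0
      · rw [h0]
        refine T.eq_root_of_adj hac ((T.mem_iff _ _).2 ⟨by omega, ha'.1⟩) fun hm => ?_
        rw [T.mem_iff] at hm
        omega
      · have := T.eq_path a (by omega)
        rwa [ha'.1, ha'.2.1] at this
    · by_cases hcq : c = q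
      · have := (T.eq_top_iff c).2 hcq
        rw [← hc'.2, this, T.top, hcq]
      · have := T.eq_path c (by omega)
        rwa [hc'.1.resolve_right hcq, hc'.2] at this
  refine sweepable_of_path hH (fun j => f (P i j)) L E ?_ ?_
    (fun j hj => f.map_adj_iff.2 (T.adj_path i j hj)) ?_ ?_
  · rintro _ (⟨v, -, rfl⟩ | hw)
    · by_cases hv : b v = i ∨ v = q
      · exact ⟨h v, T.le v, Or.inl ⟨v, hv, rfl, rfl⟩⟩
      · rw [not_or] at hv
        exact ⟨L, le_rfl, Or.inr (Or.inl ⟨v, hv.1, hv.2, rfl, rfl⟩)⟩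
    · exact ⟨h r, T.le r, Or.inr (Or.inr ⟨hw, rfl⟩)⟩
  · intro j hj
    refine Or.inl ⟨P i j, ?_, T.h_path i j hj, rfl⟩
    rcases hj.lt_or_eq with h1 | rfl
    · exact Or.inl (T.b_path i j h1)
    · exact Or.inr (T.top i)
  · have hnr : ∀ j, ((b r = i ∨ r = q) ∧ h r = j ∨ b r ≠ i ∧ r ≠ q ∧ j = L) → j = h r := by
      grind
    have hE : ∀ j w, w ∈ E j → (∃ v, ((b v = i ∨ v = q) ∧ h v = j ∨ b v ≠ i ∧ v ≠ q ∧ j = L) ∧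
        f v = w) ∨ (w ∈ D ∧ j = h r) := by
      rintro j w (⟨v, h1, h2, h3⟩ | ⟨v, h1, h2, h3, h4⟩ | h1)
      · exact Or.inl ⟨v, Or.inl ⟨h1, h2⟩, h3⟩
      · exact Or.inl ⟨v, Or.inr ⟨h1, h2, h3⟩, h4⟩
      · exact Or.inr h1
    intro j j' u v hjj hj' hu hv huv
    rcases hE _ _ hu with ⟨a, ha, rfl⟩ | ⟨hu, hj⟩ <;> rcases hE _ _ hv with ⟨c, hc, rfl⟩ | ⟨hv, hj''⟩
    · obtain ⟨h1, h2, h3⟩ := hcase j j' a c hjj (f.map_adj_iff.1 huv) ha hc hj'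
      exact ⟨h1, congrArg f h2, congrArg f h3⟩
    · obtain rfl := hD _ hv _ trivial huv.symm
      have := hnr _ ha
      omega
    · obtain rfl := hD _ hu _ trivial huv
      have := hnr _ hc
      omega
    · omega
  · intro j hj
    rcases Nat.eq_zero_or_pos j with rfl | h0
    · by_cases hr : h r = 0
      · refine (ih i r ((T.mem_iff _ _).2 ⟨hr, hi⟩) D (fun u hu v _ => hD u hu v trivial) hDr).mono ?_
        rintro w ⟨⟨v, h1, h2, rfl⟩ | ⟨v, h1, h2, h3, h4⟩ | h1, -⟩
        · refine Or.inl ⟨v, (T.mem_iff _ _).2 ⟨h2, h1.resolve_right fun e => ?_⟩, rfl⟩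
          have := (T.eq_top_iff v).2 e
          omega
        · omega
        · exact Or.inr h1.1
      · refine (ih i (P i 0) (T.root_mem i) ∅ (by simp)
          (by simpa using Sweepable.singleton H _)).mono ?_
        rintro w ⟨⟨v, h1, h2, rfl⟩ | ⟨v, h1, h2, h3, h4⟩ | h1, -⟩
        · refine Or.inl ⟨v, (T.mem_iff _ _).2 ⟨h2, h1.resolve_right fun e => ?_⟩, rfl⟩
          have := (T.eq_top_iff v).2 e
          omega
        · omega
        · exact absurd h1.2.symm hr
    rcases hj.lt_or_eq with hjL | rfl
    · refine hDs.mono ?_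
      rintro w ⟨⟨v, h1, h2, rfl⟩ | ⟨v, h1, h2, h3, h4⟩ | h1, hwx⟩
      · refine absurd ?_ hwx
        have hvq : v ≠ q := fun e => by
          have := (T.eq_top_iff v).2 e
          omega
        have := T.eq_path v (by omega)
        rw [h1.resolve_right hvq, h2] at this
        exact congrArg f this
      · omega
      · exact h1.1
    · obtain ⟨i₁, i₂, hne, hi'⟩ : ∃ i₁ i₂, i₁ ≠ i₂ ∧ ∀ i', i' ≠ i → i' = i₁ ∨ i' = i₂ :=
        (by decide : ∀ i : Fin 3, ∃ i₁ i₂, i₁ ≠ i₂ ∧ ∀ i', i' ≠ i → i' = i₁ ∨ i' = i₂) i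
      have hun := ((T.sweepable_branch hH f i₁ (ih i₁)).union hH
        (T.sweepable_branch hH f i₂ (ih i₂)) ?_).union hH
          (hDs.mono (Set.sep_subset D fun _ => h r = j)) ?_
      · refine hun.mono ?_
        rintro w ⟨⟨v, h1, h2, rfl⟩ | ⟨v, h1, h2, -, rfl⟩ | h1, hwx⟩
        · rw [T.eq_top_iff] at h2
          exact absurd (congrArg f (h2.trans (T.top i).symm)) hwx
        · rcases hi' _ h1 with h3 | h3
          · exact Or.inl (Or.inl ⟨v, ⟨h3, h2⟩, rfl⟩)
          · exact Or.inl (Or.inr ⟨v, ⟨h3, h2⟩, rfl⟩)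
        · exact Or.inr ⟨h1.1, h1.2.symm⟩
      · rintro _ ⟨v, ⟨hv, hvq⟩, rfl⟩ _ ⟨v', ⟨hv', hvq'⟩, rfl⟩ ha
        exact hne (hv.symm.trans ((T.adj_branch (f.map_adj_iff.1 ha) hvq hvq').trans hv'))
      · have hr : ∀ v ≠ q, ∀ w ∈ D, h r = j → ¬ H.Adj (f v) w := fun v hv w hw hr ha =>
          hv ((hD w hw v trivial ha.symm).trans ((T.eq_top_iff r).1 hr))
        rintro _ (⟨v, ⟨-, hv⟩, rfl⟩ | ⟨v, ⟨-, hv⟩, rfl⟩) w ⟨hw, hwr⟩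
        · exact hr v hv w hw hwr
        · exact hr v hv w hw hwr

end IsTripod

theorem sweepsAttached_of_inFam {ℓ : ℕ} : ∀ (k : ℕ) {V : Type u} {G : SimpleGraph V},
    InFam ℓ (k + 1) V G → ∀ {W : Type u} {H : SimpleGraph W}, H.Preconnected →
    ∀ f : G ↪g H, SweepsAttached G (k + 1) Set.univ H f
  | 0, _, _, hG, _, _, _, f => fun r _ D _ hD => hD.mono (by
      rintro _ (⟨v, -, rfl⟩ | hw)
      · exact Or.inl (congrArg f (hG.2 v r))
      · exact Or.inr hw)
  | k + 1, _, G, hG, W, H, hH, f => by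
    obtain ⟨S, P, q, h, b, T, hS⟩ := exists_isTripod hG
    refine T.sweepable hH f fun i r hr D hD hDr => ?_
    have := sweepsAttached_of_inFam k (hS i) hH ((SimpleGraph.Embedding.induce (S i)).trans f)
      ⟨r, hr⟩ trivial D (fun u hu v _ ha => Subtype.ext (hD u hu v v.2 ha)) hDr
    refine this.mono ?_
    rintro _ (⟨v, hv, rfl⟩ | hw)
    · exact Or.inl ⟨⟨v, hv⟩, trivial, rfl⟩
    · exact Or.inr hw

theorem sweepable_univ_of_inFam {ℓ k : ℕ} {V : Type u} {G : SimpleGraph V}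
    (hG : InFam ℓ (k + 1) V G) (r : V) : Sweepable G (k + 1) Set.univ := by
  refine (sweepsAttached_of_inFam k hG (preconnected_of_inFam _ hG) .refl r trivial ∅ (by simp)
    (by simpa using Sweepable.singleton G r)).mono fun v _ => Or.inl ⟨v, trivial, rfl⟩

end CopsRobber
namespace CopsRobber

variable {V : Type u} {G : SimpleGraph V} {k : ℕ}

/-- A sweeping schedule is a winning strategy, whatever the cops see. -/
theorem Sweepable.exists_captures (hs : Sweepable G k Set.univ) (ℓ : ℕ∞) :
    ∃ σ : CopStrategy G k, ∀ R, RobberWalk G R → Captures G ℓ σ R := by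
  classical
  obtain ⟨N, p, hp, h⟩ := hs
  let σ : CopStrategy G k :=
    { init := p 0
      move := fun l c x => if c = p ((l.length - 1) / 2) then p ((l.length - 1) / 2 + 1) x else c x
      valid := fun l c x => by
        split_ifs with hc
        · rw [hc]
          exact hp _ x
        · exact Or.inl rfl }
  have hplay : ∀ R t, copsAt G ℓ σ R t = p t ∧ (play G ℓ σ R t).2.length = 2 * t + 1 := by
    intro R t
    induction t with
    | zero => exact ⟨rfl, rfl⟩
    | succ t ih =>
      obtain ⟨h1, h2⟩ := ih
      refine ⟨?_, ?_⟩
      · have h3 : ((play G ℓ σ R t).2.length - 1) / 2 = t := by omega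
        change σ.move (play G ℓ σ R t).2 (copsAt G ℓ σ R t) = p (t + 1)
        funext x
        simp only [σ, h3, h1, if_true]
      · simp only [play, List.length_append, h2, List.length_singleton]
        omega
  refine ⟨σ, fun R hR => ?_⟩
  obtain ⟨t, -, x, hx⟩ := h R hR fun _ _ => trivial
  exact ⟨t, x, by rwa [(hplay R t).1, (hplay R (t + 1)).1]⟩

theorem Evades.mono_cops [Nonempty V] {ℓ m : ℕ} (hE : Evades G ℓ k) (hm : m ≤ k) :
    Evades G ℓ m := by
  intro p hp N
  let c : ℕ → Fin k → V := fun t x =>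
    if hx : x.1 < m then p t ⟨x, hx⟩ else Classical.arbitrary V
  have hcp : ∀ t (x : Fin m), c t (Fin.castLE hm x) = p t x := fun t x => dif_pos x.2
  have hc : IsSchedule G c := by
    intro t
    obtain ⟨π, hπ⟩ := hp t
    refine ⟨π.viaFintypeEmbedding (Fin.castLEEmb hm), fun x => ?_⟩
    by_cases hx : x ∈ Set.range (Fin.castLEEmb hm)
    · obtain ⟨x, rfl⟩ := hx
      rw [Equiv.Perm.viaFintypeEmbedding_apply_image]
      simpa only [Fin.castLEEmb_apply, hcp] using hπ x
    · rw [Equiv.Perm.viaFintypeEmbedding_apply_notMem_range _ _ hx]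
      have : ¬ x.1 < m := fun h => hx ⟨⟨x, h⟩, rfl⟩
      simp [c, this]
  obtain ⟨R, h1, h2⟩ := hE c hc N
  refine ⟨R, h1, fun t ht x => ?_⟩
  have := h2 t ht (Fin.castLE hm x)
  rwa [hcp, hcp] at this

/-- A sequence in a finite type obeying constraints on consecutive terms exists if arbitrarily long
initial segments do. -/
theorem exists_seq_of_forall_exists [Finite V] (C : ℕ → V → V → Prop)
    (hC : ∀ N, ∃ R : ℕ → V, ∀ t < N, C t (R t) (R (t + 1))) :
    ∃ R : ℕ → V, ∀ t, C t (R t) (R (t + 1)) := by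
  let _ : TopologicalSpace V := ⊥
  have : DiscreteTopology V := ⟨rfl⟩
  have hcl : ∀ N, IsClosed {R : ℕ → V | ∀ t < N, C t (R t) (R (t + 1))} := by
    intro N
    simp only [Set.ofPred_forall]
    refine isClosed_iInter fun t => isClosed_iInter fun _ => ?_
    have hcont : Continuous fun R : ℕ → V => (R t, R (t + 1)) :=
      (continuous_apply t).prodMk (continuous_apply (t + 1))
    exact (isClosed_discrete {x : V × V | C t x.1 x.2}).preimage hcont
  obtain ⟨R, hR⟩ := IsCompact.nonempty_iInter_of_sequence_nonempty_isCompact_isClosed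
    (fun N => {R : ℕ → V | ∀ t < N, C t (R t) (R (t + 1))})
    (fun N R hR t ht => hR t (by omega)) hC (hcl 0).isCompact hcl
  exact ⟨R, fun t => Set.mem_iInter.1 hR (t + 1) t (by omega)⟩

/-- A robber who can stay unseen arbitrarily long is never captured. -/
theorem Evades.exists_not_captures [Finite V] {ℓ : ℕ} (hE : Evades G ℓ k) (σ : CopStrategy G k) :
    ∃ R, RobberWalk G R ∧ ¬ Captures G ℓ σ R := by
  let c : ℕ → Fin k → V := fun t =>
    Nat.rec σ.init (fun t p => σ.move (List.replicate (2 * t + 1) none) p) t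
  have hc : ∀ t, c (t + 1) = σ.move (List.replicate (2 * t + 1) none) (c t) := fun _ => rfl
  obtain ⟨R, hR⟩ := exists_seq_of_forall_exists
    (fun t v w => (w = v ∨ G.Adj v w) ∧ Unseen G ℓ c t v) fun N => by
      obtain ⟨R, h1, h2⟩ := hE c (fun t => ⟨1, fun x => σ.valid _ _ x⟩) N
      exact ⟨R, fun t ht => ⟨h1 t ht, h2 t ht.le⟩⟩
  have hobs : ∀ (p : Fin k → V) (v : V), (∀ x, ℓ < G.dist (p x) v) → obs G (ℓ : ℕ∞) p v = none := by
    intro p v hv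
    refine if_neg ?_
    rintro ⟨x, hx⟩
    exact (hv x).not_ge (by exact_mod_cast hx)
  have hplay : ∀ t, play G ℓ σ R t = (c t, List.replicate (2 * t + 1) none) := by
    intro t
    induction t with
    | zero =>
      change (c 0, [obs G ℓ (c 0) (R 0)]) = _
      rw [hobs _ _ fun x => ((hR 0).2 x).1]
      rfl
    | succ t ih =>
      rw [play]
      simp only [ih, ← hc]
      rw [hobs _ _ fun x => ((hR t).2 x).2, hobs _ _ fun x => ((hR (t + 1)).2 x).1,
        show 2 * (t + 1) + 1 = 2 * t + 1 + 1 + 1 by omega]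
      simp only [List.replicate_succ']
  refine ⟨R, fun t => (hR t).1, ?_⟩
  rintro ⟨t, x, hx⟩
  simp only [copsAt, hplay] at hx
  have := (hR t).2 x
  rcases hx with hx | hx
  · simp [hx] at this
  · simp [hx] at this

theorem nonempty_of_inFam {ℓ : ℕ} : ∀ {k : ℕ} {V : Type u} {G : SimpleGraph V},
    InFam ℓ k V G → Nonempty V
  | 0, _, _, hG => hG.elim
  | 1, _, _, hG => hG.1
  | _ + 2, _, _, ⟨_, _, q, _⟩ => ⟨q⟩

end CopsRobber

open CopsRobber in
/-- every tree `T ∈ 𝒯_{k,ℓ}` satisfies `c_ℓ(T) = k`. -/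
theorem visCopNumber_of_inFam {V : Type} [Fintype V] (G : SimpleGraph V)
    (ℓ k : ℕ) (hk : 1 ≤ k) (hG : InFam ℓ k V G) :
    visCopNumber G (ℓ : ℕ∞) = k := by
  obtain ⟨k, rfl⟩ := Nat.exists_eq_add_of_le' hk
  have := nonempty_of_inFam hG
  have hmem := (sweepable_univ_of_inFam hG (Classical.arbitrary V)).exists_captures (ℓ : ℕ∞)
  refine le_antisymm (Nat.sInf_le hmem) (le_csInf ⟨_, hmem⟩ ?_)
  rintro m ⟨σ, hσ⟩
  by_contra! hm
  obtain ⟨R, hR, hRσ⟩ :=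
    ((evades_of_inFam k hG).mono_cops (Nat.le_of_lt_succ hm)).exists_not_captures σ
  exact hRσ (hσ R hR)
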